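/- arXiv:1603.02820 — 4 statements merged into one kernel-verified Lean document; each statement's English description precedes it below -/
import Mathlib

section
/- Define the pairing ⟨V, U⟩ = −f_V·g_U − g_V·f_U + ε₁·h_V·h_U + ε₂·l_V·l_U ∈ 𝒫 for V, U ∈ 𝒫⁴. Then for all V₁, V₂ ∈ 𝔛* and all U ∈ 𝒫⁴: D_{[V₁,V₂]}U − D_{V₁}(D_{V₂}U) + D_{V₂}(D_{V₁}U) = G·(⟨U, V₁⟩·V₂ − ⟨U, V₂⟩·V₁), where a scalar in 𝒫 multiplies a quadruple componentwise. -/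
noncomputable section
open MvPolynomial

/-- The differential algebra `𝒫`: polynomials in `k₁⁽ᵐ⁾ = X (0, m)` and `k₂⁽ᵐ⁾ = X (1, m)`. -/
abbrev PP : Type := MvPolynomial (Fin 2 × ℕ) ℝ

/-- The derivation `f ↦ f′` with `D (kᵢ⁽ᵐ⁾) = kᵢ⁽ᵐ⁺¹⁾`. -/
def Dx : Derivation ℝ PP PP :=
  MvPolynomial.mkDerivation ℝ (fun im : Fin 2 × ℕ => MvPolynomial.X (im.1, im.2 + 1))

def k1 : PP := MvPolynomial.X (0, 0)
def k2 : PP := MvPolynomial.X (1, 0)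

/-- A `𝒫`-local vector field: a quadruple `(f, h, g, l) ∈ 𝒫⁴`. -/
structure LVF where
  f : PP
  h : PP
  g : PP
  l : PP

namespace LVF

instance : Zero LVF := ⟨⟨0, 0, 0, 0⟩⟩
instance : Neg LVF := ⟨fun U => ⟨-U.f, -U.h, -U.g, -U.l⟩⟩
instance : Add LVF := ⟨fun U W => ⟨U.f + W.f, U.h + W.h, U.g + W.g, U.l + W.l⟩⟩
instance : Sub LVF := ⟨fun U W => ⟨U.f - W.f, U.h - W.h, U.g - W.g, U.l - W.l⟩⟩

def phi (a ε₁ : ℝ) (V : LVF) : PP := C a * V.f + Dx V.h - C ε₁ * k1 * V.g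

def psi (ε₂ : ℝ) (V : LVF) : PP := Dx V.l + C ε₂ * k2 * V.g

def rho (a ε₁ : ℝ) (V : LVF) : PP :=
  - C a * Dx V.f + C (2 * a) * k1 * V.h - C a * k2 * V.l
    - Dx (phi a ε₁ V) + C ε₁ * k1 * Dx V.g

/-- Membership in `𝔛*`: `g_V′ = −ε₁·a·h_V`. -/
def isStar (a ε₁ : ℝ) (V : LVF) : Prop := Dx V.g = - C (ε₁ * a) * V.h

def alpha (a ε₁ : ℝ) (V : LVF) : PP :=
  C (1 / a) * (Dx (phi a ε₁ V) + C (1 / 2) * rho a ε₁ V)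

def beta (a ε₁ ε₂ G : ℝ) (V : LVF) : PP :=
  C (1 / a) * (Dx (alpha a ε₁ V) + k1 * phi a ε₁ V - k2 * psi ε₂ V - C G * V.g)

def delta (a ε₁ ε₂ : ℝ) (V : LVF) : PP :=
  C (1 / a) * Dx (Dx (psi ε₂ V)) + k1 * psi ε₂ V + C (ε₁ * ε₂) * k2 * phi a ε₁ V

/-- The value `V̂(k₁)`. -/
def vk1 (a ε₁ ε₂ G : ℝ) (V : LVF) : PP :=
  C (1 / a ^ 2) * Dx (Dx (Dx (phi a ε₁ V)))
    + C (1 / a) * (Dx (k1 * phi a ε₁ V) + k1 * Dx (phi a ε₁ V))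
    - C (1 / a) * (Dx (k2 * psi ε₂ V) + k2 * Dx (psi ε₂ V))
    + C (1 / a) * (C (1 / (2 * a)) * Dx (Dx (rho a ε₁ V)) + k1 * rho a ε₁ V
        - C (2 * G) * Dx V.g)

/-- The value `V̂(k₂)`. -/
def vk2 (a ε₁ ε₂ G : ℝ) (V : LVF) : PP :=
  C (ε₁ * ε₂ / a ^ 2) * Dx (Dx (Dx (psi ε₂ V)))
    + C (ε₁ * ε₂ / a) * (Dx (k1 * psi ε₂ V) + k1 * Dx (psi ε₂ V))
    + C (1 / a) * (Dx (k2 * phi a ε₁ V) + k2 * Dx (phi a ε₁ V))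
    + C (1 / a) * (k2 * rho a ε₁ V) - C (ε₂ * G) * V.l

/-- Values of `V̂` on the generators, defined by the recursion
`V̂(kᵢ⁽ᵐ⁺¹⁾) = (V̂(kᵢ⁽ᵐ⁾))′ + (1/(2a))·ρ_V·kᵢ⁽ᵐ⁺¹⁾`. -/
def vhatFun (a ε₁ ε₂ G : ℝ) (V : LVF) : Fin 2 × ℕ → PP := fun im =>
  Nat.rec (motive := fun _ => PP)
    (if im.1 = 0 then vk1 a ε₁ ε₂ G V else vk2 a ε₁ ε₂ G V)
    (fun m prev => Dx prev + C (1 / (2 * a)) * rho a ε₁ V * MvPolynomial.X (im.1, m + 1))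
    im.2

/-- The derivation `V̂` attached to `V ∈ 𝔛*`. -/
def vhat (a ε₁ ε₂ G : ℝ) (V : LVF) : Derivation ℝ PP PP :=
  MvPolynomial.mkDerivation ℝ (vhatFun a ε₁ ε₂ G V)

/-- The operator `D_V U`. -/
def DV (a ε₁ ε₂ G : ℝ) (V U : LVF) : LVF where
  f := vhat a ε₁ ε₂ G V U.f - alpha a ε₁ V * U.f - beta a ε₁ ε₂ G V * U.h
        + C (ε₁ * ε₂ / a) * delta a ε₁ ε₂ V * U.l
  h := vhat a ε₁ ε₂ G V U.h + phi a ε₁ V * U.f - C ε₁ * beta a ε₁ ε₂ G V * U.g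
        - C (ε₁ * ε₂ / a) * Dx (psi ε₂ V) * U.l
  g := vhat a ε₁ ε₂ G V U.g + C ε₁ * phi a ε₁ V * U.h + alpha a ε₁ V * U.g
        + C ε₂ * psi ε₂ V * U.l
  l := vhat a ε₁ ε₂ G V U.l + psi ε₂ V * U.f + C (1 / a) * Dx (psi ε₂ V) * U.h
        + C (ε₁ / a) * delta a ε₁ ε₂ V * U.g

/-- The bracket `[V₁, V₂] = D_{V₁}V₂ − D_{V₂}V₁`. -/
def bracket (a ε₁ ε₂ G : ℝ) (V₁ V₂ : LVF) : LVF :=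
  DV a ε₁ ε₂ G V₁ V₂ - DV a ε₁ ε₂ G V₂ V₁

end LVF

/-- The pairing `⟨V, U⟩ = −f_V g_U − g_V f_U + ε₁ h_V h_U + ε₂ l_V l_U`. -/
def LVF.pair (ε₁ ε₂ : ℝ) (V U : LVF) : PP :=
  - V.f * U.g - V.g * U.f + MvPolynomial.C ε₁ * V.h * U.h + MvPolynomial.C ε₂ * V.l * U.l

/-- Componentwise multiplication of a quadruple by a scalar in `𝒫`. -/
def LVF.smulP (p : PP) (V : LVF) : LVF := ⟨p * V.f, p * V.h, p * V.g, p * V.l⟩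

set_option linter.unusedSimpArgs false

namespace LVF

variable {a ε₁ ε₂ G : ℝ}

/-- The normalization `φ_V / a²`. -/
def phiN (a ε₁ : ℝ) (V : LVF) : PP := C (1 / a ^ 2) * phi a ε₁ V

/-- The normalization `ψ_V / a²`. -/
def psiN (a ε₂ : ℝ) (V : LVF) : PP := C (1 / a ^ 2) * psi ε₂ V

/-- The normalization `ρ_V / (2a²)`. -/
def rhoN (a ε₁ : ℝ) (V : LVF) : PP := C (1 / (2 * a ^ 2)) * rho a ε₁ V

/-- The normalization `ε₁ε₂ δ_V / a`. -/
def deltaN (a ε₁ ε₂ : ℝ) (V : LVF) : PP := C (ε₁ * ε₂ / a) * delta a ε₁ ε₂ V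

theorem phi_eq (ha : a ≠ 0) (V : LVF) : phi a ε₁ V = C a ^ 2 * phiN a ε₁ V := by
  rw [phiN, ← mul_assoc, ← C_pow, ← C_mul, mul_one_div_cancel (pow_ne_zero 2 ha), C_1, one_mul]

theorem psi_eq (ha : a ≠ 0) (V : LVF) : psi ε₂ V = C a ^ 2 * psiN a ε₂ V := by
  rw [psiN, ← mul_assoc, ← C_pow, ← C_mul, mul_one_div_cancel (pow_ne_zero 2 ha), C_1, one_mul]

theorem rho_eq (ha : a ≠ 0) (V : LVF) : rho a ε₁ V = 2 * C a ^ 2 * rhoN a ε₁ V := by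
  have h : (2 * C a ^ 2 * C (1 / (2 * a ^ 2)) : PP) = 1 := by
    rw [← map_ofNat (C : ℝ →+* PP) 2, ← C_pow, ← C_mul, ← C_mul,
      mul_one_div_cancel (by positivity), C_1]
  rw [rhoN, ← mul_assoc, h, one_mul]

theorem C_ne_zero_of (ha : a ≠ 0) : (C a : PP) ≠ 0 := by simpa using ha

theorem C_mul_C_one_div (ha : a ≠ 0) : (C a * C (1 / a) : PP) = 1 := by
  rw [← C_mul, mul_one_div_cancel ha, C_1]

theorem Dx_C (r : ℝ) : Dx (C r) = 0 := derivation_C _ _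

theorem vhat_C (V : LVF) (r : ℝ) : vhat a ε₁ ε₂ G V (C r) = 0 := derivation_C _ _

theorem Dx_C_pow (r : ℝ) (n : ℕ) : Dx (C r ^ n) = 0 := by rw [← C_pow, Dx_C]

theorem vhat_C_pow (V : LVF) (r : ℝ) (n : ℕ) : vhat a ε₁ ε₂ G V (C r ^ n) = 0 := by
  rw [← C_pow, vhat_C]

theorem Dx_C_mul (r : ℝ) (p : PP) : Dx (C r * p) = C r * Dx p := by
  simp [Derivation.leibniz]

theorem Dx_mul (p q : PP) : Dx (p * q) = p * Dx q + q * Dx p := Dx.leibniz p q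

theorem vhat_mul (V : LVF) (p q : PP) : vhat a ε₁ ε₂ G V (p * q)
    = p * vhat a ε₁ ε₂ G V q + q * vhat a ε₁ ε₂ G V p := Derivation.leibniz _ p q

theorem vhat_X_succ (V : LVF) (i : Fin 2) (m : ℕ) :
    vhat a ε₁ ε₂ G V (X (i, m + 1)) = Dx (vhat a ε₁ ε₂ G V (X (i, m)))
      + C (1 / (2 * a)) * rho a ε₁ V * X (i, m + 1) := by
  simp only [vhat, mkDerivation_X, vhatFun]

theorem Dx_X (i : Fin 2) (m : ℕ) : Dx (X (i, m)) = X (i, m + 1) := mkDerivation_X _ _ _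

theorem C_one_div_two_mul_rho (ha : a ≠ 0) (V : LVF) :
    C (1 / (2 * a)) * rho a ε₁ V = C a * rhoN a ε₁ V := by
  rw [rhoN, ← mul_assoc, ← C_mul]
  congr 2
  field_simp

/-- The commutator of `V̂` with the derivation `f ↦ f′`. -/
theorem vhat_Dx (ha : a ≠ 0) (V : LVF) (p : PP) :
    vhat a ε₁ ε₂ G V (Dx p)
      = Dx (vhat a ε₁ ε₂ G V p) + C a * rhoN a ε₁ V * Dx p := by
  have h : ⁅vhat a ε₁ ε₂ G V, Dx⁆ = (C a * rhoN a ε₁ V) • Dx := by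
    refine MvPolynomial.derivation_ext fun ⟨i, m⟩ => ?_
    rw [Derivation.commutator_apply, Dx_X, vhat_X_succ, Derivation.smul_apply, Dx_X, smul_eq_mul,
      C_one_div_two_mul_rho ha, add_sub_cancel_left]
  have := congrArg (fun δ : Derivation ℝ PP PP => δ p) h
  simp only [Derivation.commutator_apply, Derivation.smul_apply, smul_eq_mul] at this
  linear_combination this

theorem Dx_h (ha : a ≠ 0) (V : LVF) :
    Dx V.h = C a ^ 2 * phiN a ε₁ V - C a * V.f + C ε₁ * k1 * V.g := by
  rw [← phi_eq ha, phi]; ring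

theorem Dx_l (ha : a ≠ 0) (V : LVF) :
    Dx V.l = C a ^ 2 * psiN a ε₂ V - C ε₂ * k2 * V.g := by
  rw [← psi_eq ha, psi]; ring

theorem C_sq_eq_one {ε : ℝ} (hε : ε = 1 ∨ ε = -1) : (C ε ^ 2 : PP) = 1 := by
  rcases hε with rfl | rfl <;> simp

theorem Dx_f (ha : a ≠ 0) (hε₁ : ε₁ = 1 ∨ ε₁ = -1) {V : LVF} (hV : isStar a ε₁ V) :
    Dx V.f = - C a * (2 * rhoN a ε₁ V + Dx (phiN a ε₁ V)) + k1 * V.h - k2 * V.l := by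
  have h := rho_eq (ε₁ := ε₁) ha V
  rw [rho, hV, phi_eq ha] at h
  have h2 : (C (2 * a) : PP) = 2 * C a := by rw [C_mul]; rfl
  simp only [← C_pow, Dx_C_mul, h2, C_mul] at h
  simp only [C_pow] at h
  apply mul_left_cancel₀ (C_ne_zero_of ha)
  linear_combination -h - C a * k1 * V.h * C_sq_eq_one hε₁

theorem alpha_eq (ha : a ≠ 0) (V : LVF) :
    alpha a ε₁ V = C a * (Dx (phiN a ε₁ V) + rhoN a ε₁ V) := by
  have h2 : (C (1 / 2) * 2 : PP) = 1 := by
    rw [← map_ofNat (C : ℝ →+* PP) 2, ← C_mul]; norm_num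
  rw [alpha, phi_eq ha, rho_eq ha, ← C_pow, Dx_C_mul, C_pow]
  linear_combination (C a * (Dx (phiN a ε₁ V) + rhoN a ε₁ V)) * C_mul_C_one_div ha
    + C (1 / a) * C a ^ 2 * rhoN a ε₁ V * h2

theorem beta_eq (ha : a ≠ 0) (V : LVF) :
    beta a ε₁ ε₂ G V = Dx (Dx (phiN a ε₁ V)) + Dx (rhoN a ε₁ V)
      + C a * (k1 * phiN a ε₁ V - k2 * psiN a ε₂ V - C (G / a ^ 2) * V.g) := by
  have hG : (C G : PP) = C a ^ 2 * C (G / a ^ 2) := by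
    rw [← C_pow, ← C_mul, mul_div_cancel₀ _ (pow_ne_zero 2 ha)]
  rw [beta, phi_eq ha, psi_eq ha, alpha_eq ha, Dx_C_mul, map_add, hG]
  linear_combination (Dx (Dx (phiN a ε₁ V)) + Dx (rhoN a ε₁ V)
      + C a * (k1 * phiN a ε₁ V - k2 * psiN a ε₂ V - C (G / a ^ 2) * V.g)) * C_mul_C_one_div ha

theorem deltaN_eq (ha : a ≠ 0) (hε₁ : ε₁ = 1 ∨ ε₁ = -1) (hε₂ : ε₂ = 1 ∨ ε₂ = -1) (V : LVF) :
    deltaN a ε₁ ε₂ V = C ε₁ * C ε₂ * (Dx (Dx (psiN a ε₂ V)) + C a * k1 * psiN a ε₂ V)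
      + C a * k2 * phiN a ε₁ V := by
  have hd : (C (ε₁ * ε₂ / a) : PP) = C ε₁ * C ε₂ * C (1 / a) := by
    rw [← C_mul, ← C_mul]; congr 1; ring
  have hab := C_mul_C_one_div ha
  rw [deltaN, delta, phi_eq ha, psi_eq ha, hd, ← C_pow, Dx_C_mul, Dx_C_mul, C_pow, C_mul]
  linear_combination (C ε₁ * C ε₂ * Dx (Dx (psiN a ε₂ V))) * (C a * C (1 / a) + 1) * hab
    + C ε₁ * C ε₂ * C a * k1 * psiN a ε₂ V * hab
    + C a * k2 * phiN a ε₁ V * (C ε₁ ^ 2 * C ε₂ ^ 2 * hab + C_sq_eq_one hε₁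
      + C ε₁ ^ 2 * C_sq_eq_one hε₂)

theorem vhat_k1 (ha : a ≠ 0) {V : LVF} (hV : isStar a ε₁ V) :
    vhat a ε₁ ε₂ G V k1 = Dx (Dx (Dx (phiN a ε₁ V))) + Dx (Dx (rhoN a ε₁ V))
      + C a * (2 * k1 * Dx (phiN a ε₁ V) + Dx k1 * phiN a ε₁ V
        - 2 * k2 * Dx (psiN a ε₂ V) - Dx k2 * psiN a ε₂ V + 2 * k1 * rhoN a ε₁ V)
      + 2 * C ε₁ * C a ^ 2 * C (G / a ^ 2) * V.h := by
  have hab := C_mul_C_one_div ha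
  have hG : (C (2 * G) : PP) = 2 * C a ^ 2 * C (G / a ^ 2) := by
    rw [← map_ofNat (C : ℝ →+* PP) 2, ← C_pow, ← C_mul, ← C_mul]; congr 1; field_simp
  have hs : (C (1 / a ^ 2) : PP) = C (1 / a) ^ 2 := by rw [← C_pow]; congr 1; ring
  have hr : C (1 / (2 * a)) * Dx (Dx (rho a ε₁ V)) = C a * Dx (Dx (rhoN a ε₁ V)) := by
    rw [← Dx_C_mul, ← Dx_C_mul, C_one_div_two_mul_rho ha, Dx_C_mul, Dx_C_mul]
  have h : vhat a ε₁ ε₂ G V k1 = vk1 a ε₁ ε₂ G V := by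
    simp [vhat, k1, mkDerivation_X, vhatFun]
  rw [h, vk1, hr, phi_eq ha, psi_eq ha, rho_eq ha, hV, hG, hs, C_mul]
  simp only [← C_pow, Dx_mul, Dx_C, mul_zero, add_zero]
  simp only [C_pow]
  linear_combination (Dx (Dx (Dx (phiN a ε₁ V))) * (C a * C (1 / a) + 1)
    + Dx (Dx (rhoN a ε₁ V))
    + C a * (2 * k1 * Dx (phiN a ε₁ V) + Dx k1 * phiN a ε₁ V
        - 2 * k2 * Dx (psiN a ε₂ V) - Dx k2 * psiN a ε₂ V + 2 * k1 * rhoN a ε₁ V)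
    + 2 * C ε₁ * C a ^ 2 * C (G / a ^ 2) * V.h) * hab

theorem vhat_k2 (ha : a ≠ 0) (V : LVF) :
    vhat a ε₁ ε₂ G V k2 = C ε₁ * C ε₂ * Dx (Dx (Dx (psiN a ε₂ V)))
      + C a * (C ε₁ * C ε₂ * (2 * k1 * Dx (psiN a ε₂ V) + Dx k1 * psiN a ε₂ V)
        + 2 * k2 * Dx (phiN a ε₁ V) + Dx k2 * phiN a ε₁ V + 2 * k2 * rhoN a ε₁ V)
      - C ε₂ * C a ^ 2 * C (G / a ^ 2) * V.l := by
  have hab := C_mul_C_one_div ha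
  have hG : (C (ε₂ * G) : PP) = C ε₂ * C a ^ 2 * C (G / a ^ 2) := by
    rw [← C_pow, ← C_mul, ← C_mul]; congr 1; field_simp
  have hs : (C (ε₁ * ε₂ / a ^ 2) : PP) = C ε₁ * C ε₂ * C (1 / a) ^ 2 := by
    rw [← C_pow, ← C_mul, ← C_mul]; congr 1; ring
  have hd : (C (ε₁ * ε₂ / a) : PP) = C ε₁ * C ε₂ * C (1 / a) := by
    rw [← C_mul, ← C_mul]; congr 1; ring
  have h : vhat a ε₁ ε₂ G V k2 = vk2 a ε₁ ε₂ G V := by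
    simp [vhat, k2, mkDerivation_X, vhatFun]
  rw [h, vk2, phi_eq ha, psi_eq ha, rho_eq ha, hG, hs, hd]
  simp only [← C_pow, Dx_mul, Dx_C, mul_zero, add_zero]
  simp only [C_pow]
  linear_combination (C ε₁ * C ε₂ * Dx (Dx (Dx (psiN a ε₂ V))) * (C a * C (1 / a) + 1)
    + C a * (C ε₁ * C ε₂ * (2 * k1 * Dx (psiN a ε₂ V) + Dx k1 * psiN a ε₂ V)
        + 2 * k2 * Dx (phiN a ε₁ V) + Dx k2 * phiN a ε₁ V + 2 * k2 * rhoN a ε₁ V)) * hab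

theorem DV_f (V U : LVF) : (DV a ε₁ ε₂ G V U).f
    = vhat a ε₁ ε₂ G V U.f - alpha a ε₁ V * U.f - beta a ε₁ ε₂ G V * U.h
      + deltaN a ε₁ ε₂ V * U.l := rfl

theorem DV_h (ha : a ≠ 0) (V U : LVF) : (DV a ε₁ ε₂ G V U).h
    = vhat a ε₁ ε₂ G V U.h + C a ^ 2 * phiN a ε₁ V * U.f - C ε₁ * beta a ε₁ ε₂ G V * U.g
      - C ε₁ * C ε₂ * C a * Dx (psiN a ε₂ V) * U.l := by
  have hd : (C (ε₁ * ε₂ / a) : PP) = C ε₁ * C ε₂ * C (1 / a) := by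
    rw [← C_mul, ← C_mul]; congr 1; ring
  rw [DV, phi_eq ha, psi_eq ha, hd, ← C_pow, Dx_C_mul, C_pow]
  linear_combination - C ε₁ * C ε₂ * C a * Dx (psiN a ε₂ V) * U.l * C_mul_C_one_div ha

theorem DV_g (ha : a ≠ 0) (V U : LVF) : (DV a ε₁ ε₂ G V U).g
    = vhat a ε₁ ε₂ G V U.g + C ε₁ * C a ^ 2 * phiN a ε₁ V * U.h + alpha a ε₁ V * U.g
      + C ε₂ * C a ^ 2 * psiN a ε₂ V * U.l := by
  rw [DV, phi_eq ha, psi_eq ha]; ring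

theorem DV_l (ha : a ≠ 0) (hε₂ : ε₂ = 1 ∨ ε₂ = -1) (V U : LVF) : (DV a ε₁ ε₂ G V U).l
    = vhat a ε₁ ε₂ G V U.l + C a ^ 2 * psiN a ε₂ V * U.f + C a * Dx (psiN a ε₂ V) * U.h
      + C ε₂ * deltaN a ε₁ ε₂ V * U.g := by
  have hd : (C (ε₁ * ε₂ / a) : PP) = C ε₂ * C (ε₁ / a) := by
    rw [← C_mul]; congr 1; ring
  rw [DV, deltaN, psi_eq ha, hd, ← C_pow, Dx_C_mul, C_pow]
  linear_combination C a * Dx (psiN a ε₂ V) * U.h * C_mul_C_one_div ha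
    - C (ε₁ / a) * delta a ε₁ ε₂ V * U.g * C_sq_eq_one hε₂

theorem bracket_f (V₁ V₂ : LVF) : (bracket a ε₁ ε₂ G V₁ V₂).f
    = (DV a ε₁ ε₂ G V₁ V₂).f - (DV a ε₁ ε₂ G V₂ V₁).f := rfl

theorem bracket_h (V₁ V₂ : LVF) : (bracket a ε₁ ε₂ G V₁ V₂).h
    = (DV a ε₁ ε₂ G V₁ V₂).h - (DV a ε₁ ε₂ G V₂ V₁).h := rfl

theorem bracket_g (V₁ V₂ : LVF) : (bracket a ε₁ ε₂ G V₁ V₂).g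
    = (DV a ε₁ ε₂ G V₁ V₂).g - (DV a ε₁ ε₂ G V₂ V₁).g := rfl

theorem bracket_l (V₁ V₂ : LVF) : (bracket a ε₁ ε₂ G V₁ V₂).l
    = (DV a ε₁ ε₂ G V₁ V₂).l - (DV a ε₁ ε₂ G V₂ V₁).l := rfl

theorem Dx_two : Dx (2 : PP) = 0 := Dx.map_natCast 2

theorem vhat_two (V : LVF) : vhat a ε₁ ε₂ G V (2 : PP) = 0 := Derivation.map_natCast _ 2

theorem Dx_g {V : LVF} (hV : isStar a ε₁ V) : Dx V.g = - C ε₁ * C a * V.h := by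
  rw [hV, C_mul]; ring

theorem isStar_bracket (ha : a ≠ 0) (hε₁ : ε₁ = 1 ∨ ε₁ = -1) (hε₂ : ε₂ = 1 ∨ ε₂ = -1)
    {V₁ V₂ : LVF} (h₁ : isStar a ε₁ V₁) (h₂ : isStar a ε₁ V₂) :
    isStar a ε₁ (bracket a ε₁ ε₂ G V₁ V₂) := by
  have e₁ := vhat_Dx (ε₁ := ε₁) (ε₂ := ε₂) (G := G) ha V₁ V₂.g
  have e₂ := vhat_Dx (ε₁ := ε₁) (ε₂ := ε₂) (G := G) ha V₂ V₁.g
  rw [Dx_g h₂] at e₁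
  rw [Dx_g h₁] at e₂
  rw [isStar, C_mul]
  simp only [bracket_f, bracket_h, bracket_g, bracket_l, DV_f, DV_h ha, DV_g ha, DV_l ha hε₂,
    map_add, map_sub, map_neg, Dx_two, vhat_two, Dx_mul, vhat_mul, Dx_C, vhat_C, Dx_C_pow,
    vhat_C_pow, mul_zero, zero_mul, add_zero, zero_add, neg_zero, alpha_eq ha, beta_eq ha,
    deltaN_eq ha hε₁ hε₂, Dx_h (ε₁ := ε₁) ha, Dx_l (ε₂ := ε₂) ha, Dx_g h₁, Dx_g h₂,
    Dx_f ha hε₁ h₁, Dx_f ha hε₁ h₂] at e₁ e₂ ⊢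
  rcases hε₁ with rfl | rfl <;> rcases hε₂ with rfl | rfl <;>
    simp only [C_neg, C_1] at e₁ e₂ ⊢ <;>
    linear_combination e₂ - e₁

theorem phiN_bracket (ha : a ≠ 0) (hε₁ : ε₁ = 1 ∨ ε₁ = -1) (hε₂ : ε₂ = 1 ∨ ε₂ = -1)
    {V₁ V₂ : LVF} (h₁ : isStar a ε₁ V₁) (h₂ : isStar a ε₁ V₂) :
    phiN a ε₁ (bracket a ε₁ ε₂ G V₁ V₂) = vhat a ε₁ ε₂ G V₁ (phiN a ε₁ V₂)
      - vhat a ε₁ ε₂ G V₂ (phiN a ε₁ V₁)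
      - (phiN a ε₁ V₁ * alpha a ε₁ V₂ - phiN a ε₁ V₂ * alpha a ε₁ V₁)
      - C ε₁ * C ε₂ * C a * (Dx (psiN a ε₂ V₁) * psiN a ε₂ V₂ - Dx (psiN a ε₂ V₂) * psiN a ε₂ V₁)
      + C (G / a ^ 2) * (V₁.h * V₂.g - V₂.h * V₁.g) := by
  have e₁ := vhat_Dx (ε₁ := ε₁) (ε₂ := ε₂) (G := G) ha V₁ V₂.h
  have e₂ := vhat_Dx (ε₁ := ε₁) (ε₂ := ε₂) (G := G) ha V₂ V₁.h
  rw [Dx_h (ε₁ := ε₁) ha V₂] at e₁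
  rw [Dx_h (ε₁ := ε₁) ha V₁] at e₂
  apply mul_left_cancel₀ (pow_ne_zero 2 (C_ne_zero_of ha))
  have e := Dx_h (ε₁ := ε₁) ha (bracket a ε₁ ε₂ G V₁ V₂)
  simp only [bracket_f, bracket_h, bracket_g, bracket_l, DV_f, DV_h ha, DV_g ha, DV_l ha hε₂,
    map_add, map_sub, map_neg, Dx_two, vhat_two, Dx_mul, vhat_mul, Dx_C, vhat_C, Dx_C_pow,
    vhat_C_pow, mul_zero, zero_mul, add_zero, zero_add, neg_zero, alpha_eq ha, beta_eq ha,
    deltaN_eq ha hε₁ hε₂, Dx_h (ε₁ := ε₁) ha, Dx_l (ε₂ := ε₂) ha, Dx_g h₁, Dx_g h₂,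
    Dx_f ha hε₁ h₁, Dx_f ha hε₁ h₂, vhat_k1 ha h₁, vhat_k1 ha h₂] at e e₁ e₂ ⊢
  rcases hε₁ with rfl | rfl <;> rcases hε₂ with rfl | rfl <;>
    simp only [C_neg, C_1] at e e₁ e₂ ⊢ <;>
    linear_combination e₂ - e₁ - e

theorem psiN_bracket (ha : a ≠ 0) (hε₁ : ε₁ = 1 ∨ ε₁ = -1) (hε₂ : ε₂ = 1 ∨ ε₂ = -1)
    {V₁ V₂ : LVF} (h₁ : isStar a ε₁ V₁) (h₂ : isStar a ε₁ V₂) :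
    psiN a ε₂ (bracket a ε₁ ε₂ G V₁ V₂) = vhat a ε₁ ε₂ G V₁ (psiN a ε₂ V₂)
      - vhat a ε₁ ε₂ G V₂ (psiN a ε₂ V₁)
      - (psiN a ε₂ V₁ * alpha a ε₁ V₂ - psiN a ε₂ V₂ * alpha a ε₁ V₁)
      + C a * (Dx (psiN a ε₂ V₁) * phiN a ε₁ V₂ - Dx (psiN a ε₂ V₂) * phiN a ε₁ V₁)
      + C (G / a ^ 2) * (V₁.l * V₂.g - V₂.l * V₁.g) := by
  have e₁ := vhat_Dx (ε₁ := ε₁) (ε₂ := ε₂) (G := G) ha V₁ V₂.l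
  have e₂ := vhat_Dx (ε₁ := ε₁) (ε₂ := ε₂) (G := G) ha V₂ V₁.l
  rw [Dx_l (ε₂ := ε₂) ha V₂] at e₁
  rw [Dx_l (ε₂ := ε₂) ha V₁] at e₂
  apply mul_left_cancel₀ (pow_ne_zero 2 (C_ne_zero_of ha))
  have e := Dx_l (ε₂ := ε₂) ha (bracket a ε₁ ε₂ G V₁ V₂)
  simp only [bracket_f, bracket_h, bracket_g, bracket_l, DV_f, DV_h ha, DV_g ha, DV_l ha hε₂,
    map_add, map_sub, map_neg, Dx_two, vhat_two, Dx_mul, vhat_mul, Dx_C, vhat_C, Dx_C_pow,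
    vhat_C_pow, mul_zero, zero_mul, add_zero, zero_add, neg_zero, alpha_eq ha, beta_eq ha,
    deltaN_eq ha hε₁ hε₂, Dx_h (ε₁ := ε₁) ha, Dx_l (ε₂ := ε₂) ha, Dx_g h₁, Dx_g h₂,
    Dx_f ha hε₁ h₁, Dx_f ha hε₁ h₂, vhat_k2 ha] at e e₁ e₂ ⊢
  rcases hε₁ with rfl | rfl <;> rcases hε₂ with rfl | rfl <;>
    simp only [C_neg, C_1] at e e₁ e₂ ⊢ <;>
    linear_combination e₂ - e₁ - e

theorem rhoN_bracket (ha : a ≠ 0) (hε₁ : ε₁ = 1 ∨ ε₁ = -1) (hε₂ : ε₂ = 1 ∨ ε₂ = -1)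
    {V₁ V₂ : LVF} (h₁ : isStar a ε₁ V₁) (h₂ : isStar a ε₁ V₂) :
    rhoN a ε₁ (bracket a ε₁ ε₂ G V₁ V₂) = vhat a ε₁ ε₂ G V₁ (rhoN a ε₁ V₂)
      - vhat a ε₁ ε₂ G V₂ (rhoN a ε₁ V₁) := by
  have e₁ := vhat_Dx (ε₁ := ε₁) (ε₂ := ε₂) (G := G) ha V₁ V₂.f
  have e₂ := vhat_Dx (ε₁ := ε₁) (ε₂ := ε₂) (G := G) ha V₂ V₁.f
  rw [Dx_f ha hε₁ h₂] at e₁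
  rw [Dx_f ha hε₁ h₁] at e₂
  apply mul_left_cancel₀ (mul_ne_zero two_ne_zero (C_ne_zero_of ha))
  have e := Dx_f ha hε₁ (isStar_bracket (G := G) ha hε₁ hε₂ h₁ h₂)
  rw [phiN_bracket ha hε₁ hε₂ h₁ h₂] at e
  simp only [bracket_f, bracket_h, bracket_g, bracket_l, DV_f, DV_h ha, DV_g ha, DV_l ha hε₂,
    map_add, map_sub, map_neg, Dx_two, vhat_two, Dx_mul, vhat_mul, Dx_C, vhat_C, Dx_C_pow,
    vhat_C_pow, mul_zero, zero_mul, add_zero, zero_add, neg_zero, alpha_eq ha, beta_eq ha,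
    deltaN_eq ha hε₁ hε₂, Dx_h (ε₁ := ε₁) ha, Dx_l (ε₂ := ε₂) ha, Dx_g h₁, Dx_g h₂,
    Dx_f ha hε₁ h₁, Dx_f ha hε₁ h₂, vhat_k1 ha h₁, vhat_k1 ha h₂, vhat_k2 ha,
    vhat_Dx ha] at e e₁ e₂ ⊢
  rcases hε₁ with rfl | rfl <;> rcases hε₂ with rfl | rfl <;>
    simp only [C_neg, C_1] at e e₁ e₂ ⊢ <;>
    linear_combination e + e₁ - e₂

theorem alpha_bracket (ha : a ≠ 0) (hε₁ : ε₁ = 1 ∨ ε₁ = -1) (hε₂ : ε₂ = 1 ∨ ε₂ = -1)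
    {V₁ V₂ : LVF} (h₁ : isStar a ε₁ V₁) (h₂ : isStar a ε₁ V₂) :
    alpha a ε₁ (bracket a ε₁ ε₂ G V₁ V₂) = vhat a ε₁ ε₂ G V₁ (alpha a ε₁ V₂)
      - vhat a ε₁ ε₂ G V₂ (alpha a ε₁ V₁)
      + (C a ^ 2 * (beta a ε₁ ε₂ G V₁ * phiN a ε₁ V₂ - deltaN a ε₁ ε₂ V₁ * psiN a ε₂ V₂))
        - (C a ^ 2 * (beta a ε₁ ε₂ G V₂ * phiN a ε₁ V₁ - deltaN a ε₁ ε₂ V₂ * psiN a ε₂ V₁))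
      + C a ^ 2 * C (G / a ^ 2) * (V₁.g * V₂.f - V₂.g * V₁.f) := by
  simp only [bracket_f, bracket_h, bracket_g, bracket_l, DV_f, DV_h ha, DV_g ha, DV_l ha hε₂,
    phiN_bracket ha hε₁ hε₂ h₁ h₂, psiN_bracket ha hε₁ hε₂ h₁ h₂, rhoN_bracket ha hε₁ hε₂ h₁ h₂,
    vhat_Dx ha, vhat_k1 ha h₁, vhat_k1 ha h₂, vhat_k2 ha, map_add, map_sub, map_neg, Dx_two,
    vhat_two, Dx_mul, vhat_mul, Dx_C, vhat_C, Dx_C_pow, vhat_C_pow, mul_zero, zero_mul, add_zero,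
    zero_add, neg_zero, alpha_eq ha, beta_eq ha, deltaN_eq ha hε₁ hε₂, Dx_h (ε₁ := ε₁) ha,
    Dx_l (ε₂ := ε₂) ha, Dx_g h₁, Dx_g h₂, Dx_f ha hε₁ h₁, Dx_f ha hε₁ h₂]
  rcases hε₁ with rfl | rfl <;> rcases hε₂ with rfl | rfl <;> simp only [C_neg, C_1] <;> ring

theorem beta_bracket (ha : a ≠ 0) (hε₁ : ε₁ = 1 ∨ ε₁ = -1) (hε₂ : ε₂ = 1 ∨ ε₂ = -1)
    {V₁ V₂ : LVF} (h₁ : isStar a ε₁ V₁) (h₂ : isStar a ε₁ V₂) :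
    beta a ε₁ ε₂ G (bracket a ε₁ ε₂ G V₁ V₂) = vhat a ε₁ ε₂ G V₁ (beta a ε₁ ε₂ G V₂)
      - vhat a ε₁ ε₂ G V₂ (beta a ε₁ ε₂ G V₁)
      + (-(alpha a ε₁ V₁ * beta a ε₁ ε₂ G V₂) - C a * deltaN a ε₁ ε₂ V₁ * Dx (psiN a ε₂ V₂))
        - (-(alpha a ε₁ V₂ * beta a ε₁ ε₂ G V₁) - C a * deltaN a ε₁ ε₂ V₂ * Dx (psiN a ε₂ V₁))
      + C a ^ 2 * C (G / a ^ 2) * C ε₁ * (V₂.h * V₁.f - V₁.h * V₂.f) := by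
  rw [beta_eq ha]
  simp only [bracket_f, bracket_h, bracket_g, bracket_l, DV_f, DV_h ha, DV_g ha, DV_l ha hε₂,
    phiN_bracket ha hε₁ hε₂ h₁ h₂, psiN_bracket ha hε₁ hε₂ h₁ h₂, rhoN_bracket ha hε₁ hε₂ h₁ h₂,
    vhat_Dx ha, vhat_k1 ha h₁, vhat_k1 ha h₂, vhat_k2 ha, map_add, map_sub, map_neg, Dx_two,
    vhat_two, Dx_mul, vhat_mul, Dx_C, vhat_C, Dx_C_pow, vhat_C_pow, mul_zero, zero_mul, add_zero,
    zero_add, neg_zero, alpha_eq ha, beta_eq ha, deltaN_eq ha hε₁ hε₂, Dx_h (ε₁ := ε₁) ha,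
    Dx_l (ε₂ := ε₂) ha, Dx_g h₁, Dx_g h₂, Dx_f ha hε₁ h₁, Dx_f ha hε₁ h₂]
  rcases hε₁ with rfl | rfl <;> rcases hε₂ with rfl | rfl <;> simp only [C_neg, C_1] <;> ring

theorem deltaN_bracket (ha : a ≠ 0) (hε₁ : ε₁ = 1 ∨ ε₁ = -1) (hε₂ : ε₂ = 1 ∨ ε₂ = -1)
    {V₁ V₂ : LVF} (h₁ : isStar a ε₁ V₁) (h₂ : isStar a ε₁ V₂) :
    deltaN a ε₁ ε₂ (bracket a ε₁ ε₂ G V₁ V₂) = vhat a ε₁ ε₂ G V₁ (deltaN a ε₁ ε₂ V₂)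
      - vhat a ε₁ ε₂ G V₂ (deltaN a ε₁ ε₂ V₁)
      + (-(alpha a ε₁ V₁ * deltaN a ε₁ ε₂ V₂)
        + C ε₁ * C ε₂ * C a * beta a ε₁ ε₂ G V₁ * Dx (psiN a ε₂ V₂))
        - (-(alpha a ε₁ V₂ * deltaN a ε₁ ε₂ V₁)
        + C ε₁ * C ε₂ * C a * beta a ε₁ ε₂ G V₂ * Dx (psiN a ε₂ V₁))
      + C a ^ 2 * C (G / a ^ 2) * C ε₂ * (V₁.l * V₂.f - V₂.l * V₁.f) := by
  simp only [bracket_f, bracket_h, bracket_g, bracket_l, DV_f, DV_h ha, DV_g ha, DV_l ha hε₂,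
    phiN_bracket ha hε₁ hε₂ h₁ h₂, psiN_bracket ha hε₁ hε₂ h₁ h₂, rhoN_bracket ha hε₁ hε₂ h₁ h₂,
    vhat_Dx ha, vhat_k1 ha h₁, vhat_k1 ha h₂, vhat_k2 ha, map_add, map_sub, map_neg, Dx_two,
    vhat_two, Dx_mul, vhat_mul, Dx_C, vhat_C, Dx_C_pow, vhat_C_pow, mul_zero, zero_mul, add_zero,
    zero_add, neg_zero, alpha_eq ha, beta_eq ha, deltaN_eq ha hε₁ hε₂, Dx_h (ε₁ := ε₁) ha,
    Dx_l (ε₂ := ε₂) ha, Dx_g h₁, Dx_g h₂, Dx_f ha hε₁ h₁, Dx_f ha hε₁ h₂]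
  rcases hε₁ with rfl | rfl <;> rcases hε₂ with rfl | rfl <;> simp only [C_neg, C_1] <;> ring

theorem Dx_psiN_bracket (ha : a ≠ 0) (hε₁ : ε₁ = 1 ∨ ε₁ = -1) (hε₂ : ε₂ = 1 ∨ ε₂ = -1)
    {V₁ V₂ : LVF} (h₁ : isStar a ε₁ V₁) (h₂ : isStar a ε₁ V₂) :
    Dx (psiN a ε₂ (bracket a ε₁ ε₂ G V₁ V₂)) = vhat a ε₁ ε₂ G V₁ (Dx (psiN a ε₂ V₂))
      - vhat a ε₁ ε₂ G V₂ (Dx (psiN a ε₂ V₁))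
      + (C ε₂ * C a * deltaN a ε₁ ε₂ V₁ * C ε₁ * phiN a ε₁ V₂
        - C a * psiN a ε₂ V₁ * beta a ε₁ ε₂ G V₂)
        - (C ε₂ * C a * deltaN a ε₁ ε₂ V₂ * C ε₁ * phiN a ε₁ V₁
        - C a * psiN a ε₂ V₂ * beta a ε₁ ε₂ G V₁)
      + C a * C (G / a ^ 2) * C ε₁ * (V₁.h * V₂.l - V₂.h * V₁.l) := by
  simp only [bracket_f, bracket_h, bracket_g, bracket_l, DV_f, DV_h ha, DV_g ha, DV_l ha hε₂,
    phiN_bracket ha hε₁ hε₂ h₁ h₂, psiN_bracket ha hε₁ hε₂ h₁ h₂, rhoN_bracket ha hε₁ hε₂ h₁ h₂,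
    vhat_Dx ha, vhat_k1 ha h₁, vhat_k1 ha h₂, vhat_k2 ha, map_add, map_sub, map_neg, Dx_two,
    vhat_two, Dx_mul, vhat_mul, Dx_C, vhat_C, Dx_C_pow, vhat_C_pow, mul_zero, zero_mul, add_zero,
    zero_add, neg_zero, alpha_eq ha, beta_eq ha, deltaN_eq ha hε₁ hε₂, Dx_h (ε₁ := ε₁) ha,
    Dx_l (ε₂ := ε₂) ha, Dx_g h₁, Dx_g h₂, Dx_f ha hε₁ h₁, Dx_f ha hε₁ h₂]
  rcases hε₁ with rfl | rfl <;> rcases hε₂ with rfl | rfl <;> simp only [C_neg, C_1] <;> ring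

theorem vhat_bracket_k1 (ha : a ≠ 0) (hε₁ : ε₁ = 1 ∨ ε₁ = -1) (hε₂ : ε₂ = 1 ∨ ε₂ = -1)
    {V₁ V₂ : LVF} (h₁ : isStar a ε₁ V₁) (h₂ : isStar a ε₁ V₂) :
    vhat a ε₁ ε₂ G (bracket a ε₁ ε₂ G V₁ V₂) k1 = vhat a ε₁ ε₂ G V₁ (vhat a ε₁ ε₂ G V₂ k1)
      - vhat a ε₁ ε₂ G V₂ (vhat a ε₁ ε₂ G V₁ k1) := by
  rw [vhat_k1 ha (isStar_bracket ha hε₁ hε₂ h₁ h₂)]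
  simp only [bracket_f, bracket_h, bracket_g, bracket_l, DV_f, DV_h ha, DV_g ha, DV_l ha hε₂,
    phiN_bracket ha hε₁ hε₂ h₁ h₂, psiN_bracket ha hε₁ hε₂ h₁ h₂, rhoN_bracket ha hε₁ hε₂ h₁ h₂,
    vhat_Dx ha, vhat_k1 ha h₁, vhat_k1 ha h₂, vhat_k2 ha, map_add, map_sub, map_neg, Dx_two,
    vhat_two, Dx_mul, vhat_mul, Dx_C, vhat_C, Dx_C_pow, vhat_C_pow, mul_zero, zero_mul, add_zero,
    zero_add, neg_zero, alpha_eq ha, beta_eq ha, deltaN_eq ha hε₁ hε₂, Dx_h (ε₁ := ε₁) ha,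
    Dx_l (ε₂ := ε₂) ha, Dx_g h₁, Dx_g h₂, Dx_f ha hε₁ h₁, Dx_f ha hε₁ h₂]
  rcases hε₁ with rfl | rfl <;> rcases hε₂ with rfl | rfl <;> simp only [C_neg, C_1] <;> ring

theorem vhat_bracket_k2 (ha : a ≠ 0) (hε₁ : ε₁ = 1 ∨ ε₁ = -1) (hε₂ : ε₂ = 1 ∨ ε₂ = -1)
    {V₁ V₂ : LVF} (h₁ : isStar a ε₁ V₁) (h₂ : isStar a ε₁ V₂) :
    vhat a ε₁ ε₂ G (bracket a ε₁ ε₂ G V₁ V₂) k2 = vhat a ε₁ ε₂ G V₁ (vhat a ε₁ ε₂ G V₂ k2)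
      - vhat a ε₁ ε₂ G V₂ (vhat a ε₁ ε₂ G V₁ k2) := by
  rw [vhat_k2 ha]
  simp only [bracket_f, bracket_h, bracket_g, bracket_l, DV_f, DV_h ha, DV_g ha, DV_l ha hε₂,
    phiN_bracket ha hε₁ hε₂ h₁ h₂, psiN_bracket ha hε₁ hε₂ h₁ h₂, rhoN_bracket ha hε₁ hε₂ h₁ h₂,
    vhat_Dx ha, vhat_k1 ha h₁, vhat_k1 ha h₂, vhat_k2 ha, map_add, map_sub, map_neg, Dx_two,
    vhat_two, Dx_mul, vhat_mul, Dx_C, vhat_C, Dx_C_pow, vhat_C_pow, mul_zero, zero_mul, add_zero,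
    zero_add, neg_zero, alpha_eq ha, beta_eq ha, deltaN_eq ha hε₁ hε₂, Dx_h (ε₁ := ε₁) ha,
    Dx_l (ε₂ := ε₂) ha, Dx_g h₁, Dx_g h₂, Dx_f ha hε₁ h₁, Dx_f ha hε₁ h₂]
  rcases hε₁ with rfl | rfl <;> rcases hε₂ with rfl | rfl <;> simp only [C_neg, C_1] <;> ring

/-- `V ↦ V̂` intertwines the bracket of vector fields with the commutator of derivations. -/
theorem vhat_bracket (ha : a ≠ 0) (hε₁ : ε₁ = 1 ∨ ε₁ = -1) (hε₂ : ε₂ = 1 ∨ ε₂ = -1)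
    {V₁ V₂ : LVF} (h₁ : isStar a ε₁ V₁) (h₂ : isStar a ε₁ V₂) :
    vhat a ε₁ ε₂ G (bracket a ε₁ ε₂ G V₁ V₂) = ⁅vhat a ε₁ ε₂ G V₁, vhat a ε₁ ε₂ G V₂⁆ := by
  refine MvPolynomial.derivation_ext fun ⟨i, m⟩ => ?_
  rw [Derivation.commutator_apply]
  induction m with
  | zero =>
    fin_cases i
    · exact vhat_bracket_k1 ha hε₁ hε₂ h₁ h₂
    · exact vhat_bracket_k2 ha hε₁ hε₂ h₁ h₂
  | succ m ih =>
    rw [← Dx_X]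
    simp only [vhat_Dx ha, map_add, vhat_mul, vhat_C, ih, map_sub, Dx_mul, Dx_C,
      rhoN_bracket ha hε₁ hε₂ h₁ h₂]
    ring

end LVF

open LVF in
/-- The curvature identity for operators `D_V`. -/
theorem stmt11 (a ε₁ ε₂ G : ℝ) (ha : a ≠ 0) (hε₁ : ε₁ = 1 ∨ ε₁ = -1)
    (hε₂ : ε₂ = 1 ∨ ε₂ = -1) (V₁ V₂ : LVF)
    (h₁ : LVF.isStar a ε₁ V₁) (h₂ : LVF.isStar a ε₁ V₂) (U : LVF) :
    DV a ε₁ ε₂ G (bracket a ε₁ ε₂ G V₁ V₂) U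
        - DV a ε₁ ε₂ G V₁ (DV a ε₁ ε₂ G V₂ U)
        + DV a ε₁ ε₂ G V₂ (DV a ε₁ ε₂ G V₁ U)
      = smulP (MvPolynomial.C G)
          (smulP (pair ε₁ ε₂ U V₁) V₂ - smulP (pair ε₁ ε₂ U V₂) V₁) := by
  have hG : (C G : PP) = C a ^ 2 * C (G / a ^ 2) := by
    rw [← C_pow, ← C_mul, mul_div_cancel₀ _ (pow_ne_zero 2 ha)]
  have hadd (V W : LVF) : V + W = ⟨V.f + W.f, V.h + W.h, V.g + W.g, V.l + W.l⟩ := rfl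
  have hsub (V W : LVF) : V - W = ⟨V.f - W.f, V.h - W.h, V.g - W.g, V.l - W.l⟩ := rfl
  simp only [hadd, hsub, smulP, pair, hG, LVF.mk.injEq]
  simp only [DV_f, DV_h ha, DV_g ha, DV_l ha hε₂, Dx_psiN_bracket ha hε₁ hε₂ h₁ h₂]
  simp only [vhat_bracket ha hε₁ hε₂ h₁ h₂,
    Derivation.commutator_apply, alpha_bracket ha hε₁ hε₂ h₁ h₂, beta_bracket ha hε₁ hε₂ h₁ h₂,
      deltaN_bracket ha hε₁ hε₂ h₁ h₂, phiN_bracket ha hε₁ hε₂ h₁ h₂, psiN_bracket ha hε₁ hε₂ h₁ h₂,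
    map_add, map_sub, vhat_mul, vhat_C, vhat_C_pow, mul_zero, add_zero]
  rcases hε₁ with rfl | rfl <;> rcases hε₂ with rfl | rfl <;> simp only [C_neg, C_1] <;>
    refine ⟨?_, ?_, ?_, ?_⟩ <;> ring
end
end

section
/- The bracket [·,·] on 𝔛* is skew-symmetric and satisfies the Jacobi identity: for all V₁, V₂, V₃ ∈ 𝔛*, [V₁, V₂] = −[V₂, V₁] and [[V₁, V₂], V₃] + [[V₂, V₃], V₁] + [[V₃, V₁], V₂] = 0. Consequently (𝔛*, [·,·]) is a Lie algebra over ℝ. -/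
noncomputable section
open MvPolynomial

namespace LVF

attribute [ext] LVF

@[simp] theorem sub_f (U W : LVF) : (U - W).f = U.f - W.f := rfl
@[simp] theorem sub_h (U W : LVF) : (U - W).h = U.h - W.h := rfl
@[simp] theorem sub_g (U W : LVF) : (U - W).g = U.g - W.g := rfl
@[simp] theorem sub_l (U W : LVF) : (U - W).l = U.l - W.l := rfl

@[simp] theorem add_f (U W : LVF) : (U + W).f = U.f + W.f := rfl
@[simp] theorem add_h (U W : LVF) : (U + W).h = U.h + W.h := rfl
@[simp] theorem add_g (U W : LVF) : (U + W).g = U.g + W.g := rfl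
@[simp] theorem add_l (U W : LVF) : (U + W).l = U.l + W.l := rfl

@[simp] theorem neg_f (U : LVF) : (-U).f = -U.f := rfl
@[simp] theorem neg_h (U : LVF) : (-U).h = -U.h := rfl
@[simp] theorem neg_g (U : LVF) : (-U).g = -U.g := rfl
@[simp] theorem neg_l (U : LVF) : (-U).l = -U.l := rfl

@[simp] theorem zero_f : (0 : LVF).f = 0 := rfl
@[simp] theorem zero_h : (0 : LVF).h = 0 := rfl
@[simp] theorem zero_g : (0 : LVF).g = 0 := rfl
@[simp] theorem zero_l : (0 : LVF).l = 0 := rfl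

end LVF

theorem Dx_X (i : Fin 2) (m : ℕ) : Dx (X (i, m)) = X (i, m + 1) :=
  mkDerivation_X ..

theorem vhat_k1 (a ε₁ ε₂ G : ℝ) (V : LVF) :
    LVF.vhat a ε₁ ε₂ G V k1 = LVF.vk1 a ε₁ ε₂ G V := by
  simp [LVF.vhat, k1, mkDerivation_X, LVF.vhatFun]

theorem vhat_k2 (a ε₁ ε₂ G : ℝ) (V : LVF) :
    LVF.vhat a ε₁ ε₂ G V k2 = LVF.vk2 a ε₁ ε₂ G V := by
  simp [LVF.vhat, k2, mkDerivation_X, LVF.vhatFun]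

theorem Dx_vhat (a ε₁ ε₂ G : ℝ) (V : LVF) (p : PP) :
    Dx (LVF.vhat a ε₁ ε₂ G V p) =
      LVF.vhat a ε₁ ε₂ G V (Dx p) - C (1 / (2 * a)) * LVF.rho a ε₁ V * Dx p := by
  have key : ⁅LVF.vhat a ε₁ ε₂ G V, Dx⁆ = (C (1 / (2 * a)) * LVF.rho a ε₁ V) • Dx := by
    refine derivation_ext fun im => ?_
    obtain ⟨i, m⟩ := im
    have h : LVF.vhat a ε₁ ε₂ G V (X (i, m + 1)) = Dx (LVF.vhat a ε₁ ε₂ G V (X (i, m))) +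
        C (1 / (2 * a)) * LVF.rho a ε₁ V * X (i, m + 1) := by
      simp only [LVF.vhat, mkDerivation_X, LVF.vhatFun]
    rw [Derivation.commutator_apply, Derivation.smul_apply, smul_eq_mul, Dx_X, h]
    ring
  have h := congrArg (fun E => E p) key
  simp only [Derivation.commutator_apply, Derivation.smul_apply, smul_eq_mul] at h
  linear_combination -h

/-- A derivation of `𝒫` together with the entries of a matrix that is skew for the metric of the
moving frame. -/
structure SkewConn where
  E : Derivation ℝ PP PP
  al : PP
  be : PP
  ph : PP
  ps : PP
  c : PP
  d : PP

namespace SkewConn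

/-- The action of a connection on quadruples. -/
def act (ε₁ ε₂ : ℝ) (X : SkewConn) (U : LVF) : LVF where
  f := X.E U.f - X.al * U.f - X.be * U.h + C ε₁ * C ε₂ * X.d * U.l
  h := X.E U.h + X.ph * U.f - C ε₁ * X.be * U.g - C ε₁ * C ε₂ * X.c * U.l
  g := X.E U.g + C ε₁ * X.ph * U.h + X.al * U.g + C ε₂ * X.ps * U.l
  l := X.E U.l + X.ps * U.f + X.c * U.h + C ε₁ * X.d * U.g

/-- The commutator of `X` and `Y`, minus the curvature operator
`Z ↦ G (⟨W, Z⟩ V - ⟨V, Z⟩ W)` of constant curvature `G`. -/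
def curvedComm (ε₁ ε₂ G : ℝ) (X Y : SkewConn) (V W : LVF) : SkewConn where
  E := ⁅X.E, Y.E⁆
  al := X.E Y.al - Y.E X.al + X.be * Y.ph - C ε₁ * C ε₂ * X.d * Y.ps
    - Y.be * X.ph + C ε₁ * C ε₂ * Y.d * X.ps - C G * (W.g * V.f - V.g * W.f)
  be := X.E Y.be - Y.E X.be - X.al * Y.be - C ε₁ * C ε₂ * X.d * Y.c
    + Y.al * X.be + C ε₁ * C ε₂ * Y.d * X.c - C G * C ε₁ * (V.h * W.f - W.h * V.f)
  ph := X.E Y.ph - Y.E X.ph - X.ph * Y.al - C ε₁ * C ε₂ * X.c * Y.ps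
    + Y.ph * X.al + C ε₁ * C ε₂ * Y.c * X.ps - C G * (V.g * W.h - W.g * V.h)
  ps := X.E Y.ps - Y.E X.ps - X.ps * Y.al + X.c * Y.ph
    + Y.ps * X.al - Y.c * X.ph - C G * (V.g * W.l - W.g * V.l)
  c := X.E Y.c - Y.E X.c - X.ps * Y.be + X.d * Y.ph
    + Y.ps * X.be - Y.d * X.ph - C G * C ε₁ * (W.h * V.l - V.h * W.l)
  d := X.E Y.d - Y.E X.d - X.c * Y.be + X.d * Y.al
    + Y.c * X.be - Y.d * X.al - C G * C ε₁ * (V.f * W.l - W.f * V.l)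

/-- The connection `D_V`. -/
def ofField (a ε₁ ε₂ G : ℝ) (V : LVF) : SkewConn where
  E := LVF.vhat a ε₁ ε₂ G V
  al := LVF.alpha a ε₁ V
  be := LVF.beta a ε₁ ε₂ G V
  ph := LVF.phi a ε₁ V
  ps := LVF.psi ε₂ V
  c := C (1 / a) * Dx (LVF.psi ε₂ V)
  d := C (1 / a) * LVF.delta a ε₁ ε₂ V

/-- `X` extends `V` to a variation of the framed curve with `[V, T] = P T`: the commutator of `X`
with the Frenet connection is `P` times the Frenet connection plus the curvature of `V` and `T`,
and `X` is torsion-free along `V`. -/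
structure IsVariation (a ε₁ ε₂ G : ℝ) (X : SkewConn) (P : PP) (V : LVF) : Prop where
  Dx_E : ∀ p, Dx (X.E p) = X.E (Dx p) - P * Dx p
  Dx_ph : Dx X.ph = C a * X.al - C a * P
  Dx_ps : Dx X.ps = C a * X.c
  Dx_al : Dx X.al = C a * X.be - k1 * X.ph + k2 * X.ps + C G * V.g
  Dx_be : Dx X.be = X.E k1 - X.al * k1 + k2 * X.c - P * k1 - C G * C ε₁ * V.h
  Dx_c : Dx X.c = C a * X.d - k1 * X.ps - C ε₁ * C ε₂ * k2 * X.ph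
  Dx_d : Dx X.d = C ε₁ * C ε₂ * X.E k2 - X.c * k1 - C ε₁ * C ε₂ * k2 * X.al
    - C ε₁ * C ε₂ * P * k2 + C G * C ε₁ * V.l
  Dx_f : Dx V.f = k1 * V.h - k2 * V.l - X.al - P
  Dx_h : Dx V.h = X.ph - C a * V.f + C ε₁ * k1 * V.g
  Dx_g : Dx V.g = - (C ε₁ * C a * V.h)
  Dx_l : Dx V.l = X.ps - C ε₂ * k2 * V.g

set_option maxHeartbeats 4000000 in
/-- The bracket of two variations is a variation. -/
theorem IsVariation.curvedComm {a ε₁ ε₂ G : ℝ} (hε₁ : ε₁ = 1 ∨ ε₁ = -1)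
    (hε₂ : ε₂ = 1 ∨ ε₂ = -1) {X Y : SkewConn} {P Q : PP} {V W : LVF}
    (hX : IsVariation a ε₁ ε₂ G X P V) (hY : IsVariation a ε₁ ε₂ G Y Q W) :
    IsVariation a ε₁ ε₂ G (curvedComm ε₁ ε₂ G X Y V W) (X.E Q - Y.E P)
      (act ε₁ ε₂ X W - act ε₁ ε₂ Y V) := by
  obtain ⟨x0, x1, x2, x3, x4, x5, x6, x7, x8, x9, x10⟩ := hX
  obtain ⟨y0, y1, y2, y3, y4, y5, y6, y7, y8, y9, y10⟩ := hY
  rcases hε₁ with rfl | rfl <;> rcases hε₂ with rfl | rfl <;>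
  simp only [map_one, map_neg, one_mul, neg_mul] at * <;>
  constructor <;> intros <;>
  simp only [SkewConn.curvedComm, act, LVF.sub_f, LVF.sub_h, LVF.sub_g, LVF.sub_l,
    Derivation.commutator_apply, map_sub, map_add, map_neg, map_one, one_mul, neg_mul,
    Derivation.leibniz, smul_eq_mul, derivation_C, Derivation.map_one_eq_zero, mul_one, *] <;>
  ring

/-- A vector field of `𝔛*` determines a variation. -/
theorem isVariation_ofField {a ε₁ ε₂ G : ℝ} (ha : a ≠ 0) (hε₁ : ε₁ = 1 ∨ ε₁ = -1)
    (hε₂ : ε₂ = 1 ∨ ε₂ = -1) {V : LVF} (hV : LVF.isStar a ε₁ V) :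
    IsVariation a ε₁ ε₂ G (ofField a ε₁ ε₂ G V) (C (1 / (2 * a)) * LVF.rho a ε₁ V) V := by
  have hinv : (C a : PP) * C a⁻¹ = 1 := by rw [← C_mul, mul_inv_cancel₀ ha, C_1]
  have htwo : (2 : PP) * C (2⁻¹ : ℝ) = 1 := by
    rw [← map_ofNat (C : ℝ →+* PP) 2, ← C_mul, mul_inv_cancel₀ two_ne_zero, C_1]
  have hsq₁ : (C ε₁ : PP) * C ε₁ = 1 := by
    rcases hε₁ with rfl | rfl <;> simp
  have hsq₂ : (C ε₂ : PP) * C ε₂ = 1 := by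
    rcases hε₂ with rfl | rfl <;> simp
  have hg : Dx V.g = - (C ε₁ * C a * V.h) := by
    rw [hV, C_mul, neg_mul]
  have hf : C (1 / (2 * a)) * LVF.rho a ε₁ V = C 2⁻¹ * C a⁻¹ * LVF.rho a ε₁ V := by
    rw [one_div, mul_inv, C_mul]
  have hk1 := vhat_k1 a ε₁ ε₂ G V
  have hk2 := vhat_k2 a ε₁ ε₂ G V
  rw [hf]
  constructor
  · intro p
    rw [← hf]
    exact Dx_vhat a ε₁ ε₂ G V p
  all_goals
    simp only [ofField, LVF.alpha, LVF.beta, LVF.delta, hk1, hk2, LVF.vk1, LVF.vk2,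
      div_eq_mul_inv, one_mul, mul_inv, ← inv_pow, C_mul, C_pow, map_add, map_sub,
      Derivation.leibniz, smul_eq_mul, derivation_C, hg, map_ofNat, mul_zero, add_zero]
  · linear_combination (-Dx (LVF.phi a ε₁ V)) * hinv
  · linear_combination (-Dx (LVF.psi ε₂ V)) * hinv
  · linear_combination (-(C a⁻¹ * (Dx (Dx (LVF.phi a ε₁ V)) + C 2⁻¹ * Dx (LVF.rho a ε₁ V))
      + k1 * LVF.phi a ε₁ V - k2 * LVF.psi ε₂ V - C G * V.g)) * hinv
  · linear_combination (C a⁻¹ * LVF.rho a ε₁ V * k1) * htwo - (C G * C ε₁ * V.h) * hinv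
  · linear_combination (-(C a⁻¹ * Dx (Dx (LVF.psi ε₂ V)) + k1 * LVF.psi ε₂ V
      + C ε₁ * C ε₂ * k2 * LVF.phi a ε₁ V)) * hinv
  · linear_combination (-(C a⁻¹ ^ 2 * Dx (Dx (Dx (LVF.psi ε₂ V))) + C a⁻¹ *
        (2 * k1 * Dx (LVF.psi ε₂ V) + LVF.psi ε₂ V * Dx k1))) * (C ε₂ * C ε₂ * hsq₁ + hsq₂)
      + (C ε₁ * C ε₂ * C a⁻¹ * k2 * LVF.rho a ε₁ V) * htwo + (C ε₁ * C G * V.l) * hsq₂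
  · have hrho : LVF.rho a ε₁ V = - (C a * Dx V.f) + 2 * C a * k1 * V.h - C a * k2 * V.l
        - Dx (LVF.phi a ε₁ V) - C ε₁ * C ε₁ * C a * k1 * V.h := by
      rw [LVF.rho, hg, C_mul, map_ofNat]
      ring
    linear_combination (C a⁻¹ * LVF.rho a ε₁ V) * htwo + C a⁻¹ * hrho
      + (-Dx V.f + 2 * k1 * V.h - k2 * V.l - C ε₁ * C ε₁ * k1 * V.h) * hinv
      - k1 * V.h * hsq₁
  · rw [LVF.phi]
    ring
  · rw [LVF.psi]
    ring

/-- The variation extending a given vector field is unique. -/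
theorem IsVariation.unique {a ε₁ ε₂ G : ℝ} (ha : a ≠ 0) (hε₁ : ε₁ = 1 ∨ ε₁ = -1)
    (hε₂ : ε₂ = 1 ∨ ε₂ = -1) {X Y : SkewConn} {P Q : PP} {V : LVF}
    (hX : IsVariation a ε₁ ε₂ G X P V) (hY : IsVariation a ε₁ ε₂ G Y Q V) : X = Y := by
  have ha' : (C a : PP) ≠ 0 := by simpa using ha
  have hsq₁ : (C ε₁ : PP) * C ε₁ = 1 := by
    rcases hε₁ with rfl | rfl <;> simp
  have hsq₂ : (C ε₂ : PP) * C ε₂ = 1 := by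
    rcases hε₂ with rfl | rfl <;> simp
  obtain ⟨x0, x1, x2, x3, x4, x5, x6, x7, x8, x9, x10⟩ := hX
  obtain ⟨y0, y1, y2, y3, y4, y5, y6, y7, y8, y9, y10⟩ := hY
  obtain ⟨E, al, be, ph, ps, c, d⟩ := X
  obtain ⟨E', al', be', ph', ps', c', d'⟩ := Y
  dsimp only at *
  obtain rfl : ph = ph' := by linear_combination y8 - x8
  obtain rfl : ps = ps' := by linear_combination y10 - x10
  obtain rfl : c = c' := mul_left_cancel₀ ha' (by linear_combination y2 - x2)
  have hsub : al - P = al' - Q := mul_left_cancel₀ ha' (by linear_combination y1 - x1)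
  obtain rfl : al = al' :=
    mul_left_cancel₀ (two_ne_zero (α := PP)) (by linear_combination hsub + x7 - y7)
  obtain rfl : P = Q := by linear_combination -hsub
  obtain rfl : be = be' := mul_left_cancel₀ ha' (by linear_combination y3 - x3)
  obtain rfl : d = d' := mul_left_cancel₀ ha' (by linear_combination y5 - x5)
  have hk1 : E k1 = E' k1 := by linear_combination y4 - x4
  have hk2 : E k2 = E' k2 := by
    linear_combination (C ε₁ * C ε₂) * (y6 - x6)
      - (E k2 - E' k2) * (C ε₂ * C ε₂ * hsq₁ + hsq₂)
  obtain rfl : E = E' := by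
    refine derivation_ext fun im => ?_
    obtain ⟨i, m⟩ := im
    induction m with
    | zero => fin_cases i <;> assumption
    | succ m ih =>
      have hx := x0 (X (i, m))
      have hy := y0 (X (i, m))
      rw [Dx_X] at hx hy
      rw [ih] at hx
      linear_combination hy - hx
  rfl

set_option maxHeartbeats 4000000 in
/-- The algebraic Bianchi identity of constant curvature, summed over the three variations. -/
theorem act_curvedComm_cyclic {ε₁ ε₂ : ℝ} (hε₁ : ε₁ = 1 ∨ ε₁ = -1) (hε₂ : ε₂ = 1 ∨ ε₂ = -1)
    (G : ℝ) (X Y Z : SkewConn) (U V W : LVF) :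
    (act ε₁ ε₂ (curvedComm ε₁ ε₂ G X Y U V) W
        - act ε₁ ε₂ Z (act ε₁ ε₂ X V - act ε₁ ε₂ Y U))
      + (act ε₁ ε₂ (curvedComm ε₁ ε₂ G Y Z V W) U
        - act ε₁ ε₂ X (act ε₁ ε₂ Y W - act ε₁ ε₂ Z V))
      + (act ε₁ ε₂ (curvedComm ε₁ ε₂ G Z X W U) V
        - act ε₁ ε₂ Y (act ε₁ ε₂ Z U - act ε₁ ε₂ X W)) = 0 := by
  rcases hε₁ with rfl | rfl <;> rcases hε₂ with rfl | rfl <;> ext1 <;>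
  simp only [SkewConn.curvedComm, act, LVF.sub_f, LVF.sub_h, LVF.sub_g, LVF.sub_l, LVF.add_f,
    LVF.add_h, LVF.add_g, LVF.add_l, LVF.zero_f, LVF.zero_h, LVF.zero_g, LVF.zero_l,
    Derivation.commutator_apply, map_sub, map_add, map_neg, map_one, one_mul, neg_mul,
    Derivation.leibniz, smul_eq_mul] <;>
  ring

end SkewConn

theorem LVF.DV_eq_act (a ε₁ ε₂ G : ℝ) (V U : LVF) :
    LVF.DV a ε₁ ε₂ G V U = SkewConn.act ε₁ ε₂ (SkewConn.ofField a ε₁ ε₂ G V) U := by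
  ext1 <;>
  simp only [LVF.DV, SkewConn.act, SkewConn.ofField, div_eq_mul_inv, C_mul, one_mul] <;>
  ring

/-- On `𝔛*` the bracket is compatible with the commutator of connections, up to curvature. -/
theorem LVF.ofField_bracket {a ε₁ ε₂ G : ℝ} (ha : a ≠ 0) (hε₁ : ε₁ = 1 ∨ ε₁ = -1)
    (hε₂ : ε₂ = 1 ∨ ε₂ = -1) {V W : LVF} (hV : LVF.isStar a ε₁ V) (hW : LVF.isStar a ε₁ W) :
    SkewConn.ofField a ε₁ ε₂ G (LVF.bracket a ε₁ ε₂ G V W) =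
      SkewConn.curvedComm ε₁ ε₂ G (SkewConn.ofField a ε₁ ε₂ G V)
        (SkewConn.ofField a ε₁ ε₂ G W) V W := by
  have h := (SkewConn.isVariation_ofField (G := G) ha hε₁ hε₂ hV).curvedComm hε₁ hε₂
    (SkewConn.isVariation_ofField (G := G) ha hε₁ hε₂ hW)
  rw [← LVF.DV_eq_act, ← LVF.DV_eq_act] at h
  refine (SkewConn.isVariation_ofField ha hε₁ hε₂ ?_).unique ha hε₁ hε₂ h
  rw [LVF.isStar, C_mul, neg_mul]
  exact h.Dx_g

open LVF in
/-- The bracket on `𝔛*` is skew-symmetric and satisfies the Jacobi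
identity; consequently `(𝔛*, [·,·])` is a Lie algebra over `ℝ`. -/
theorem stmt12 (a ε₁ ε₂ G : ℝ) (ha : a ≠ 0) (hε₁ : ε₁ = 1 ∨ ε₁ = -1)
    (hε₂ : ε₂ = 1 ∨ ε₂ = -1) :
    (∀ V₁ V₂ : LVF, isStar a ε₁ V₁ → isStar a ε₁ V₂ →
      bracket a ε₁ ε₂ G V₁ V₂ = - bracket a ε₁ ε₂ G V₂ V₁) ∧
    (∀ V₁ V₂ V₃ : LVF, isStar a ε₁ V₁ → isStar a ε₁ V₂ → isStar a ε₁ V₃ →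
      bracket a ε₁ ε₂ G (bracket a ε₁ ε₂ G V₁ V₂) V₃
        + bracket a ε₁ ε₂ G (bracket a ε₁ ε₂ G V₂ V₃) V₁
        + bracket a ε₁ ε₂ G (bracket a ε₁ ε₂ G V₃ V₁) V₂ = 0) := by
  refine ⟨fun V₁ V₂ _ _ => ?_, fun V₁ V₂ V₃ h₁ h₂ h₃ => ?_⟩
  · ext1 <;> simp [bracket]
  · have hb (V W : LVF) : bracket a ε₁ ε₂ G V W =
        SkewConn.act ε₁ ε₂ (SkewConn.ofField a ε₁ ε₂ G V) W -
          SkewConn.act ε₁ ε₂ (SkewConn.ofField a ε₁ ε₂ G W) V := by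
      rw [bracket, DV_eq_act, DV_eq_act]
    rw [hb (bracket a ε₁ ε₂ G V₁ V₂), hb (bracket a ε₁ ε₂ G V₂ V₃),
      hb (bracket a ε₁ ε₂ G V₃ V₁), ofField_bracket ha hε₁ hε₂ h₁ h₂,
      ofField_bracket ha hε₁ hε₂ h₂ h₃, ofField_bracket ha hε₁ hε₂ h₃ h₁]
    simp only [hb]
    exact SkewConn.act_curvedComm_cyclic hε₁ hε₂ G _ _ _ V₁ V₂ V₃
end
end

section
/- For u ∈ 𝒫 set θu = (1/a)u‴ + k₁u′ + (k₁u)′ and Su = (k₂u)′ + k₂u′. If φ, ψ ∈ 𝒫 satisfy θφ − Sψ = 0 and Sφ + ε₁ε₂·θψ = 0, then φ = 0 and ψ = 0. -/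
noncomputable section
open MvPolynomial

/-- The operator `θu = (1/a)u‴ + k₁u′ + (k₁u)′`. -/
def thetaOp (a : ℝ) (u : PP) : PP :=
  MvPolynomial.C (1 / a) * Dx (Dx (Dx u)) + k1 * Dx u + Dx (k1 * u)

/-- The operator `Su = (k₂u)′ + k₂u′`. -/
def SOp (u : PP) : PP := Dx (k2 * u) + k2 * Dx u

/-- `OrderLT m f`: the differential polynomial `f` does not involve `kᵢ⁽ʲ⁾` for `j ≥ m`. -/
def OrderLT (m : ℕ) (f : PP) : Prop := ∀ i j, m ≤ j → pderiv (i, j) f = 0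

namespace OrderLT

variable {m n : ℕ} {f g : PP}

theorem mono (hf : OrderLT m f) (h : m ≤ n) : OrderLT n f :=
  fun i j hj => hf i j (h.trans hj)

theorem add (hf : OrderLT m f) (hg : OrderLT m g) : OrderLT m (f + g) := fun i j hj => by
  rw [map_add, hf i j hj, hg i j hj, add_zero]

theorem mul (hf : OrderLT m f) (hg : OrderLT m g) : OrderLT m (f * g) := fun i j hj => by
  rw [pderiv_mul, hf i j hj, hg i j hj, zero_mul, mul_zero, add_zero]

theorem const (m : ℕ) (c : ℝ) : OrderLT m (C c) := fun _ _ _ => pderiv_C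

theorem gen (i : Fin 2) (m : ℕ) : OrderLT (m + 1) (X (i, m)) := fun i' j hj =>
  pderiv_X_of_ne fun h => by
    have := congrArg Prod.snd h
    simp only at this
    omega

theorem exists_of (f : PP) : ∃ m, OrderLT m f := by
  refine ⟨f.vars.sup Prod.snd + 1, fun i j hj => pderiv_eq_zero_of_notMem_vars fun h => ?_⟩
  have : j ≤ f.vars.sup Prod.snd := Finset.le_sup (f := Prod.snd) h
  omega

end OrderLT

/-- The commutation relation `[∂/∂kᵢ⁽ʲ⁺¹⁾, D] = ∂/∂kᵢ⁽ʲ⁾`. -/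
theorem pderiv_succ_Dx (i : Fin 2) (j : ℕ) (f : PP) :
    pderiv (i, j + 1) (Dx f) = Dx (pderiv (i, j + 1) f) + pderiv (i, j) f := by
  have key : ⁅pderiv (R := ℝ) (i, j + 1), Dx⁆ = pderiv (i, j) := by
    refine derivation_ext fun p => ?_
    obtain ⟨i', j'⟩ := p
    rw [Derivation.commutator_apply, Dx_X]
    have hc : Dx (pderiv (i, j + 1) (X (i', j'))) = 0 := by
      by_cases h : (i', j') = (i, j + 1)
      · rw [h, pderiv_X_self, Derivation.map_one_eq_zero]
      · rw [pderiv_X_of_ne h, map_zero]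
    rw [hc, sub_zero]
    by_cases h : (i', j') = (i, j)
    · obtain ⟨rfl, rfl⟩ := Prod.mk.inj h
      rw [pderiv_X_self, pderiv_X_self]
    · rw [pderiv_X_of_ne h, pderiv_X_of_ne]
      simpa using h
  rw [← key, Derivation.commutator_apply]
  ring

namespace OrderLT

variable {m : ℕ} {f : PP}

theorem pderiv_Dx (hf : OrderLT (m + 1) f) (i : Fin 2) :
    pderiv (i, m + 1) (Dx f) = pderiv (i, m) f := by
  rw [pderiv_succ_Dx, hf i (m + 1) le_rfl, map_zero, zero_add]

theorem dx (hf : OrderLT m f) : OrderLT (m + 1) (Dx f) := by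
  intro i j hj
  obtain ⟨j, rfl⟩ : ∃ l, j = l + 1 := ⟨j - 1, by omega⟩
  rw [pderiv_succ_Dx, hf i (j + 1) (by omega), hf i j (by omega), map_zero, add_zero]

/-- A differential polynomial of order less than `0` is a constant. -/
theorem eq_C (hf : OrderLT 0 f) : f = C (coeff 0 f) := by
  classical
  ext s
  rw [coeff_C]
  split_ifs with h
  · rw [h]
  · obtain ⟨⟨i, j⟩, hp⟩ := Finsupp.ne_iff.mp (Ne.symm h)
    have hc := coeff_pderiv (i := (i, j)) f (s - Finsupp.single (i, j) 1)
    have hs : s - Finsupp.single (i, j) 1 + Finsupp.single (i, j) 1 = s :=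
      tsub_add_cancel_of_le (Finsupp.single_le_iff.mpr (Nat.one_le_iff_ne_zero.mpr hp))
    rw [hf i j (Nat.zero_le j), coeff_zero, hs] at hc
    exact (mul_eq_zero.mp hc.symm).resolve_right (by positivity)

end OrderLT

/-- The leading term of `θφ + c·Sψ` comes from `(1/a)φ‴`, so a solution `φ` of
`θφ + c·Sψ = 0` has order strictly below any common bound for the orders of `φ` and `ψ`. -/
theorem OrderLT.of_thetaOp_add {a c : ℝ} (ha : a ≠ 0) {m : ℕ} {φ ψ : PP}
    (hφ : OrderLT (m + 1) φ) (hψ : OrderLT (m + 1) ψ)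
    (h : thetaOp a φ + C c * SOp ψ = 0) : OrderLT m φ := by
  intro i j hj
  obtain rfl | hlt := hj.eq_or_lt
  swap
  · exact hφ i j hlt
  have hk1 : OrderLT (m + 1) k1 := (OrderLT.gen 0 0).mono (by omega)
  have hk2 : OrderLT (m + 1) k2 := (OrderLT.gen 1 0).mono (by omega)
  have hlow : OrderLT (m + 3) (k1 * Dx φ + Dx (k1 * φ) + C c * SOp ψ) :=
    ((((hk1.mono (Nat.le_succ _)).mul hφ.dx).add (hk1.mul hφ).dx).add
      ((OrderLT.const _ c).mul
        ((hk2.mul hψ).dx.add ((hk2.mono (Nat.le_succ _)).mul hψ.dx)))).mono (Nat.le_succ _)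
  have hsplit : thetaOp a φ + C c * SOp ψ =
      C (1 / a) * Dx (Dx (Dx φ)) + (k1 * Dx φ + Dx (k1 * φ) + C c * SOp ψ) := by
    rw [thetaOp]
    ring
  have htop := congrArg (pderiv (i, m + 3)) (hsplit.symm.trans h)
  rw [map_add, hlow i (m + 3) le_rfl, add_zero, map_zero, pderiv_C_mul, hφ.dx.dx.pderiv_Dx,
    hφ.dx.pderiv_Dx, hφ.pderiv_Dx] at htop
  exact (mul_eq_zero.mp htop).resolve_left (C_ne_zero.mpr (one_div_ne_zero ha))

/-- If `x` and `y` are constants with `θx − Sy = 0`, then `x = y = 0`. -/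
theorem eq_zero_of_thetaOp_C_sub_SOp_C {a x y : ℝ}
    (h : thetaOp a (C x) - SOp (C y) = 0) : x = 0 ∧ y = 0 := by
  have h' : X (0, 1) * C x - X (1, 1) * C y = (0 : PP) := by
    simpa [thetaOp, SOp, k1, k2, Dx_X, mul_comm, derivation_C] using h
  exact ⟨by simpa using congrArg (pderiv (0, 1)) h', by simpa using congrArg (pderiv (1, 1)) h'⟩

/-- The operator `(φ,ψ) ↦ (θφ − Sψ, Sφ + ε₁ε₂θψ)` has trivial kernel. -/
theorem stmt16 (a ε₁ ε₂ : ℝ) (ha : a ≠ 0) (hε₁ : ε₁ = 1 ∨ ε₁ = -1)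
    (hε₂ : ε₂ = 1 ∨ ε₂ = -1) (φ ψ : PP)
    (h1 : thetaOp a φ - SOp ψ = 0)
    (h2 : SOp φ + MvPolynomial.C (ε₁ * ε₂) * thetaOp a ψ = 0) :
    φ = 0 ∧ ψ = 0 := by
  have hε : (C (ε₁ * ε₂) : PP) * C (ε₁ * ε₂) = 1 := by
    rw [← C_mul]
    rcases hε₁ with rfl | rfl <;> rcases hε₂ with rfl | rfl <;> norm_num
  have e1 : thetaOp a φ + C (-1) * SOp ψ = 0 := by
    rw [C_neg, C_1]
    linear_combination h1
  have e2 : thetaOp a ψ + C (ε₁ * ε₂) * SOp φ = 0 := by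
    linear_combination C (ε₁ * ε₂) * h2 - thetaOp a ψ * hε
  have key : ∀ m, OrderLT m φ → OrderLT m ψ → OrderLT 0 φ ∧ OrderLT 0 ψ := by
    intro m
    induction m with
    | zero => exact And.intro
    | succ m ih =>
      exact fun hφ hψ => ih (hφ.of_thetaOp_add ha hψ e1) (hψ.of_thetaOp_add ha hφ e2)
  obtain ⟨m, hm⟩ := OrderLT.exists_of φ
  obtain ⟨n, hn⟩ := OrderLT.exists_of ψ
  obtain ⟨hφ, hψ⟩ := key (max m n) (hm.mono (le_max_left m n)) (hn.mono (le_max_right m n))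
  rw [hφ.eq_C, hψ.eq_C] at h1
  obtain ⟨hx, hy⟩ := eq_zero_of_thetaOp_C_sub_SOp_C h1
  rw [hφ.eq_C, hψ.eq_C, hx, hy, C_0]
  exact ⟨rfl, rfl⟩
end
end

section
/- Set G = 0. Let h, l ∈ 𝒫 and suppose p, q ∈ 𝒫 satisfy p′ = h and q′ = k₁h − k₂l. Define V = (−(1/(2a))·(h′ + a·k₁p − a·q), h, −ε₁·a·p, l) ∈ 𝒫⁴. Then V ∈ 𝔛* with ρ_V = 0, and: (i) φ_V = (1/2)h′ + (a/2)(k₁p + q) and ψ_V = l′ − ε₁ε₂·a·k₂p (the symplectic relation); (ii) V̂(k₁) = (1/a)·(θφ_V − Sψ_V) and V̂(k₂) = (1/a)·(Sφ_V + ε₁ε₂·θψ_V), where θu = (1/a)u‴ + k₁u′ + (k₁u)′ and Su = (k₂u)′ + k₂u′. In particular the curvature flow (V̂(k₁), V̂(k₂)) is obtained from the pair (2h, −ε₁ε₂l) by applying first the symplectic operator J and then the cosymplectic operator Θ of the Hirota–Satsuma system (the recursion relation). -/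
noncomputable section
open MvPolynomial

/-- The vector field `𝒳(h, l)` built from `h`, `l` and antiderivatives `p`, `q`
(with zero constants of integration). -/
def XVF (a ε₁ : ℝ) (h l p q : PP) : LVF :=
  ⟨- MvPolynomial.C (1 / (2 * a)) * (Dx h + MvPolynomial.C a * k1 * p - MvPolynomial.C a * q),
    h, - MvPolynomial.C (ε₁ * a) * p, l⟩

/-- Constants pull out of the derivation `Dx`. -/
theorem Dx_C_mul (r : ℝ) (u : PP) : Dx (C r * u) = C r * Dx u := by
  rw [← smul_eq_C_mul, Derivation.map_smul, smul_eq_C_mul]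

namespace LVF

theorem vhat_k1_s18 (a ε₁ ε₂ G : ℝ) (V : LVF) : vhat a ε₁ ε₂ G V k1 = vk1 a ε₁ ε₂ G V :=
  mkDerivation_X _ _ _

theorem vhat_k2_s18 (a ε₁ ε₂ G : ℝ) (V : LVF) : vhat a ε₁ ε₂ G V k2 = vk2 a ε₁ ε₂ G V :=
  mkDerivation_X _ _ _

theorem vk1_eq_of_rho_eq_zero (a ε₁ ε₂ : ℝ) (V : LVF) (hρ : rho a ε₁ V = 0) :
    vk1 a ε₁ ε₂ 0 V = C (1 / a) * (thetaOp a (phi a ε₁ V) - SOp (psi ε₂ V)) := by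
  have hC : (C (1 / a ^ 2) : PP) = C (1 / a) * C (1 / a) := by
    rw [← C_mul]; congr 1; ring
  simp only [vk1, thetaOp, SOp, hρ, hC, map_zero, mul_zero, zero_mul]
  ring

theorem vk2_eq_of_rho_eq_zero (a ε₁ ε₂ : ℝ) (V : LVF) (hρ : rho a ε₁ V = 0) :
    vk2 a ε₁ ε₂ 0 V =
      C (1 / a) * (SOp (phi a ε₁ V) + C (ε₁ * ε₂) * thetaOp a (psi ε₂ V)) := by
  have hC : (C (ε₁ * ε₂ / a ^ 2) : PP) = C (ε₁ * ε₂) * C (1 / a) * C (1 / a) := by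
    rw [← C_mul, ← C_mul]; congr 1; ring
  have hC' : (C (ε₁ * ε₂ / a) : PP) = C (ε₁ * ε₂) * C (1 / a) := by
    rw [← C_mul]; congr 1; ring
  simp only [vk2, thetaOp, SOp, hρ, hC, hC', map_zero, mul_zero, zero_mul]
  ring

theorem isStar_XVF (a ε₁ : ℝ) {h p : PP} (l q : PP) (hp : Dx p = h) :
    isStar a ε₁ (XVF a ε₁ h l p q) := by
  simp only [isStar, XVF, neg_mul, map_neg, Dx_C_mul, hp]

theorem phi_XVF {a ε₁ : ℝ} (ha : a ≠ 0) (hε₁ : ε₁ = 1 ∨ ε₁ = -1) (h l p q : PP) :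
    phi a ε₁ (XVF a ε₁ h l p q) = C (1 / 2) * Dx h + C (a / 2) * (k1 * p + q) := by
  have hε : (C ε₁ * C ε₁ : PP) = 1 := by
    rw [← C_mul, ← C_1]; congr 1; rcases hε₁ with rfl | rfl <;> norm_num
  have ha₁ : (C a * C (1 / (2 * a)) : PP) = C (1 / 2) := by
    rw [← C_mul]; congr 1; field_simp
  have ha₂ : (C (a / 2) : PP) = C (1 / 2) * C a := by
    rw [← C_mul]; congr 1; ring
  have h2 : (2 * C (1 / 2) : PP) = 1 := by
    rw [← C_1, ← map_ofNat C 2, ← C_mul]; congr 1; norm_num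
  simp only [phi, XVF, ha₂, C_mul (a := ε₁)]
  linear_combination (-(Dx h + C a * k1 * p - C a * q)) * ha₁ + C a * k1 * p * hε
    - (Dx h + C a * k1 * p) * h2

theorem psi_XVF (a ε₁ ε₂ : ℝ) (h l p q : PP) :
    psi ε₂ (XVF a ε₁ h l p q) = Dx l - C (ε₁ * ε₂ * a) * k2 * p := by
  simp only [psi, XVF, C_mul]
  ring

theorem rho_XVF {a ε₁ : ℝ} (ha : a ≠ 0) (hε₁ : ε₁ = 1 ∨ ε₁ = -1) {h l p q : PP}
    (hp : Dx p = h) (hq : Dx q = k1 * h - k2 * l) :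
    rho a ε₁ (XVF a ε₁ h l p q) = 0 := by
  have hε : (C ε₁ * C ε₁ : PP) = 1 := by
    rw [← C_mul, ← C_1]; congr 1; rcases hε₁ with rfl | rfl <;> norm_num
  have hg : Dx (XVF a ε₁ h l p q).g = -C (ε₁ * a) * h := isStar_XVF a ε₁ l q hp
  have hφ : phi a ε₁ (XVF a ε₁ h l p q) =
      C a * (XVF a ε₁ h l p q).f + Dx h + C a * (k1 * p) := by
    simp only [phi, XVF, C_mul]
    linear_combination C a * k1 * p * hε
  have hsum : C a * (XVF a ε₁ h l p q).f + phi a ε₁ (XVF a ε₁ h l p q) = C a * q := by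
    have h2 : (2 * (C a * C (1 / (2 * a))) : PP) = 1 := by
      rw [← C_1, ← map_ofNat C 2, ← C_mul, ← C_mul]; congr 1; field_simp
    rw [hφ]
    simp only [XVF]
    linear_combination (-(Dx h + C a * k1 * p - C a * q)) * h2
  have hD := congrArg Dx hsum
  rw [map_add, Dx_C_mul, Dx_C_mul, hq] at hD
  have h2a : (C (2 * a) : PP) = 2 * C a := by rw [C_mul, map_ofNat]
  rw [rho, hg, h2a, C_mul]
  simp only [XVF] at hD ⊢
  linear_combination -hD - C a * k1 * h * hε

end LVF

open LVF in
/-- The symplectic and recursion relations for the field `𝒳(h, l)`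
(case `G = 0`). -/
theorem stmt18 (a ε₁ ε₂ : ℝ) (ha : a ≠ 0) (hε₁ : ε₁ = 1 ∨ ε₁ = -1)
    (hε₂ : ε₂ = 1 ∨ ε₂ = -1) (h l p q : PP)
    (hp : Dx p = h) (hq : Dx q = k1 * h - k2 * l) :
    isStar a ε₁ (XVF a ε₁ h l p q) ∧ rho a ε₁ (XVF a ε₁ h l p q) = 0 ∧
    phi a ε₁ (XVF a ε₁ h l p q) =
      MvPolynomial.C (1 / 2) * Dx h + MvPolynomial.C (a / 2) * (k1 * p + q) ∧
    psi ε₂ (XVF a ε₁ h l p q) = Dx l - MvPolynomial.C (ε₁ * ε₂ * a) * k2 * p ∧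
    vhat a ε₁ ε₂ 0 (XVF a ε₁ h l p q) k1 =
      MvPolynomial.C (1 / a) *
        (thetaOp a (phi a ε₁ (XVF a ε₁ h l p q)) - SOp (psi ε₂ (XVF a ε₁ h l p q))) ∧
    vhat a ε₁ ε₂ 0 (XVF a ε₁ h l p q) k2 =
      MvPolynomial.C (1 / a) *
        (SOp (phi a ε₁ (XVF a ε₁ h l p q))
          + MvPolynomial.C (ε₁ * ε₂) * thetaOp a (psi ε₂ (XVF a ε₁ h l p q))) := by
  have hρ := rho_XVF ha hε₁ hp hq
  exact ⟨isStar_XVF a ε₁ l q hp, hρ, phi_XVF ha hε₁ h l p q, psi_XVF a ε₁ ε₂ h l p q,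
    (vhat_k1_s18 ..).trans (vk1_eq_of_rho_eq_zero a ε₁ ε₂ _ hρ),
    (vhat_k2_s18 ..).trans (vk2_eq_of_rho_eq_zero a ε₁ ε₂ _ hρ)⟩
end
end
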